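/- There is an absolute constant c > 0 such that for every n divisible by 4, every τ ≥ 1, every m with 1 ≤ m ≤ 3n/4, and every δ ≥ 0, there exist ε > 0 and a set X of n entities with piecewise-linear trajectories of τ edges each such that the number of distinct maximal groups (pairs (G, I_G) with G a maximal group on I_G, for parameters ε, m, δ) is at least c·τ·n³. -/

import Mathlib

open Set

/-- The plane with the Euclidean metric. -/
abbrev Plane : Type := EuclideanSpace ℝ (Fin 2)

/-- `f` is a piecewise-linear trajectory with breakpoints `t 0, …, t τ`:
it is (the restriction of) an affine map on each interval `[t i, t (i+1)]`. -/
def IsPLTrajectory (τ : ℕ) (t : Fin (τ + 1) → ℝ) (f : ℝ → Plane) : Prop :=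
  ∀ i : Fin τ, ∃ g : ℝ →ᵃ[ℝ] Plane,
    ∀ s ∈ Icc (t i.castSucc) (t i.succ), f s = g s

/-- Entities `x` and `y` are directly connected at time `s`: their `ε`-discs overlap. -/
def DirectlyConnected {n : ℕ} (p : Fin n → ℝ → Plane) (ε s : ℝ) (x y : Fin n) : Prop :=
  dist (p x s) (p y s) ≤ 2 * ε

/-- Entities `x` and `y` are `ε`-connected at time `s`: there is a sequence
`x = x_0, …, x_k = y` of entities with consecutive ones directly connected at `s`. -/
def EpsConnected {n : ℕ} (p : Fin n → ℝ → Plane) (ε s : ℝ) : Fin n → Fin n → Prop :=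
  Relation.ReflTransGen (DirectlyConnected p ε s)

/-- A component at time `s` is a maximal set of pairwise `ε`-connected entities. -/
def IsComponent {n : ℕ} (p : Fin n → ℝ → Plane) (ε s : ℝ) (C : Set (Fin n)) : Prop :=
  (∀ x ∈ C, ∀ y ∈ C, EpsConnected p ε s x y) ∧
  (∀ D : Set (Fin n), C ⊆ D → (∀ x ∈ D, ∀ y ∈ D, EpsConnected p ε s x y) → D = C)
/-- `G` is a group on the interval `[a, b] ⊆ [t0, tτ]` for parameters `ε`, `m`, `δ`:
it has at least `m` entities, the interval has length at least `δ`, and at every time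
`s ∈ [a, b]` all of `G` lies in a single component. -/
def IsGroup {n : ℕ} (p : Fin n → ℝ → Plane) (ε : ℝ) (m : ℕ) (δ t0 tτ : ℝ)
    (G : Finset (Fin n)) (a b : ℝ) : Prop :=
  m ≤ G.card ∧ t0 ≤ a ∧ a ≤ b ∧ b ≤ tτ ∧ δ ≤ b - a ∧
  ∀ s ∈ Icc a b, ∃ C : Set (Fin n), IsComponent p ε s C ∧ ↑G ⊆ C

/-- `G` is a maximal group on `[a, b]`: it is a group on `[a, b]`, and the only group
`(H, [c, d])` covering `(G, [a, b])` (i.e. with `G ⊆ H` and `[a, b] ⊆ [c, d]`) is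
`(G, [a, b])` itself. -/
def IsMaximalGroup {n : ℕ} (p : Fin n → ℝ → Plane) (ε : ℝ) (m : ℕ) (δ t0 tτ : ℝ)
    (G : Finset (Fin n)) (a b : ℝ) : Prop :=
  IsGroup p ε m δ t0 tτ G a b ∧
  ∀ (H : Finset (Fin n)) (c d : ℝ), IsGroup p ε m δ t0 tτ H c d →
    G ⊆ H → c ≤ a → b ≤ d → H = G ∧ c = a ∧ d = b

noncomputable def tri (L v : ℝ) : ℝ := L * |v / L - round (v / L)|

lemma tri_up {L v : ℝ} (hL : 0 < L) (j : ℤ) (h1 : L * j ≤ v) (h2 : v ≤ L * j + L / 2) :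
    tri L v = v - L * j := by
  unfold tri
  obtain ⟨x, rfl⟩ : ∃ x, v = L * x := ⟨v / L, by field_simp⟩
  have e : L * x / L = x := by field_simp
  rw [e]
  have h1' : (j : ℝ) ≤ x := by
    by_contra hh; push Not at hh; nlinarith
  have h2' : x ≤ j + 1 / 2 := by
    by_contra hh; push Not at hh; nlinarith
  have : |x - round x| = x - j := by
    apply le_antisymm
    · have := round_le x j
      rwa [abs_of_nonneg (by linarith : (0:ℝ) ≤ x - j)] at this
    · rcases le_or_gt (round x) j with h | h
      · have : ((round x : ℤ) : ℝ) ≤ j := by exact_mod_cast h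
        exact le_trans (by linarith) (le_abs_self _)
      · have : (j : ℝ) + 1 ≤ ((round x : ℤ) : ℝ) := by exact_mod_cast h
        exact le_trans (by linarith) (neg_le_abs _)
  rw [this]; ring

lemma tri_down {L v : ℝ} (hL : 0 < L) (j : ℤ) (h1 : L * j + L / 2 ≤ v) (h2 : v ≤ L * (j + 1)) :
    tri L v = L * (j + 1) - v := by
  unfold tri
  obtain ⟨x, rfl⟩ : ∃ x, v = L * x := ⟨v / L, by field_simp⟩
  have e : L * x / L = x := by field_simp
  rw [e]
  have h1' : (j : ℝ) + 1 / 2 ≤ x := by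
    by_contra hh; push Not at hh; nlinarith
  have h2' : x ≤ j + 1 := by
    by_contra hh; push Not at hh; nlinarith
  have : |x - round x| = j + 1 - x := by
    apply le_antisymm
    · have := round_le x (j + 1)
      push_cast at this
      rw [abs_of_nonpos (by linarith : x - ((j:ℝ) + 1) ≤ 0)] at this
      linarith
    · rcases le_or_gt (round x) j with h | h
      · have : ((round x : ℤ) : ℝ) ≤ j := by exact_mod_cast h
        exact le_trans (by linarith) (le_abs_self _)
      · have : (j : ℝ) + 1 ≤ ((round x : ℤ) : ℝ) := by exact_mod_cast h
        exact le_trans (by linarith) (neg_le_abs _)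
  rw [this]; ring

lemma eps_symm {n : ℕ} {p : Fin n → ℝ → Plane} {ε s : ℝ} {x y : Fin n}
    (h : EpsConnected p ε s x y) : EpsConnected p ε s y x := by
  unfold EpsConnected at *
  induction h with
  | refl => exact Relation.ReflTransGen.refl
  | tail _ hd ih =>
    refine Relation.ReflTransGen.head ?_ ih
    unfold DirectlyConnected at *
    rwa [dist_comm]

open Classical in
noncomputable def grp {n : ℕ} (p : Fin n → ℝ → Plane) (ε : ℝ) (z : Fin n) (a b : ℝ) :
    Finset (Fin n) :=
  Finset.univ.filter (fun x => ∀ s ∈ Icc a b, EpsConnected p ε s z x)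

lemma max_of {n : ℕ} (p : Fin n → ℝ → Plane) (ε : ℝ) (m : ℕ) (δ t0 tτ : ℝ) (z : Fin n)
    (a b : ℝ) (hm : m ≤ (grp p ε z a b).card) (h0 : t0 ≤ a) (hab : a ≤ b) (h1 : b ≤ tτ)
    (hδ : δ ≤ b - a) (e1 e2 : Fin n)
    (he1 : ∀ s ∈ Icc a b, EpsConnected p ε s z e1)
    (he2 : ∀ s ∈ Icc a b, EpsConnected p ε s z e2)
    (hl : ∀ c < a, ∃ s ∈ Icc c a, ¬ EpsConnected p ε s z e1)
    (hr : ∀ d > b, ∃ s ∈ Icc b d, ¬ EpsConnected p ε s z e2) :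
    IsMaximalGroup p ε m δ t0 tτ (grp p ε z a b) a b := by
  refine ⟨⟨hm, h0, hab, h1, hδ, ?_⟩, ?_⟩
  · intro s hs
    refine ⟨{y | EpsConnected p ε s z y}, ⟨?_, ?_⟩, ?_⟩
    · intro x hx y hy
      exact (eps_symm hx).trans hy
    · intro D hD hD2
      apply Subset.antisymm _ hD
      intro y hy
      exact hD2 z (hD Relation.ReflTransGen.refl) y hy
    · intro x hx
      simp only [grp, Finset.coe_filter, Finset.mem_univ, true_and, mem_ofPred_eq] at hx
      exact hx s hs
  · intro H c d hH hGH hca hbd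
    obtain ⟨-, -, hcd, -, -, hC⟩ := hH
    have hz : z ∈ H := hGH (by
      simp only [grp, Finset.mem_filter, Finset.mem_univ, true_and]
      intro s _; exact Relation.ReflTransGen.refl)
    have key : ∀ x ∈ H, ∀ s ∈ Icc c d, EpsConnected p ε s z x := by
      intro x hx s hs
      obtain ⟨C, ⟨hC1, -⟩, hHC⟩ := hC s hs
      exact hC1 z (hHC hz) x (hHC hx)
    have m1 : e1 ∈ H := hGH (by
      simp only [grp, Finset.mem_filter, Finset.mem_univ, true_and]; exact he1)
    have m2 : e2 ∈ H := hGH (by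
      simp only [grp, Finset.mem_filter, Finset.mem_univ, true_and]; exact he2)
    refine ⟨?_, ?_, ?_⟩
    · apply Finset.Subset.antisymm _ hGH
      intro x hx
      simp only [grp, Finset.mem_filter, Finset.mem_univ, true_and]
      intro s hs
      exact key x hx s ⟨hca.trans hs.1, hs.2.trans hbd⟩
    · by_contra hne
      obtain ⟨s, hs, hn⟩ := hl c (lt_of_le_of_ne hca hne)
      exact hn (key e1 m1 s ⟨hs.1, by linarith [hs.2]⟩)
    · by_contra hne
      obtain ⟨s, hs, hn⟩ := hr d (lt_of_le_of_ne hbd (Ne.symm hne))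
      exact hn (key e2 m2 s ⟨by linarith [hs.1], hs.2⟩)

noncomputable def traj (k : ℕ) (lam : ℝ) (x : ℕ) (s : ℝ) : Plane :=
  if x < 3 * k then !₂[(x : ℝ), 0]
  else !₂[tri (8 * k) (s / lam) - ((x : ℝ) - 3 * k) * (1 + 1 / k), 12 / 13]

lemma dist_le_one (a b c d : ℝ) :
    dist (!₂[a, b] : Plane) !₂[c, d] ≤ 2 * (1 / 2) ↔ (a - c) ^ 2 + (b - d) ^ 2 ≤ 1 := by
  rw [EuclideanSpace.dist_eq]
  simp only [Fin.sum_univ_two, Real.dist_eq, sq_abs]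
  simp

lemma traj_pl (k : ℕ) (hk : 0 < k) (lam : ℝ) (hl : 0 < lam) (τ x : ℕ) :
    IsPLTrajectory τ (fun i : Fin (τ + 1) => lam * (4 * k) * (i : ℕ)) (traj k lam x) := by
  intro i
  by_cases hx : x < 3 * k
  · exact ⟨AffineMap.const ℝ ℝ !₂[(x : ℝ), 0], fun s _ => by simp [traj, hx]⟩
  · have hk' : (0 : ℝ) < k := by exact_mod_cast hk
    have hL : (0 : ℝ) < 8 * k := by positivity
    have aux : ∃ A B : ℝ, ∀ s ∈ Icc (lam * (4 * k) * ((i : ℕ) : ℝ)) (lam * (4 * k) * (((i : ℕ) + 1 : ℕ) : ℝ)),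
        tri (8 * k) (s / lam) = s * A + B := by
      rcases Nat.even_or_odd' (i : ℕ) with ⟨j, hj | hj⟩
      · refine ⟨1 / lam, - (8 * k * j), ?_⟩
        rintro s ⟨h1, h2⟩
        rw [hj] at h1 h2
        push_cast at h1 h2
        rw [tri_up hL (j : ℤ)]
        · push_cast; ring
        · rw [le_div_iff₀ hl]; push_cast; nlinarith
        · rw [div_le_iff₀ hl]; push_cast; nlinarith
      · refine ⟨-(1 / lam), (8 * k * (j + 1)), ?_⟩
        rintro s ⟨h1, h2⟩
        rw [hj] at h1 h2
        push_cast at h1 h2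
        rw [tri_down hL (j : ℤ)]
        · push_cast; ring
        · rw [le_div_iff₀ hl]; push_cast; nlinarith
        · rw [div_le_iff₀ hl]; push_cast; nlinarith
    obtain ⟨A, B, hAB⟩ := aux
    refine ⟨(LinearMap.toSpanSingleton ℝ Plane !₂[A, 0]).toAffineMap +
      AffineMap.const ℝ ℝ !₂[B - ((x : ℝ) - 3 * k) * (1 + 1 / k), 12 / 13], ?_⟩
    intro s hs
    have := hAB s (by simpa using hs)
    ext l
    fin_cases l
    · simp [traj, hx, this]; ring
    · simp [traj, hx]

/-- core entities are always connected -/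
lemma core_conn (k n : ℕ) (hn : n = 4 * k) (lam s : ℝ) (z : Fin n) (hz : (z : ℕ) = 0) :
    ∀ (i : ℕ) (hi : i < n), i < 3 * k →
      EpsConnected (fun x : Fin n => traj k lam x) (1 / 2) s z ⟨i, hi⟩ := by
  intro i
  induction i with
  | zero =>
    intro hi _
    have : z = ⟨0, hi⟩ := Fin.ext hz
    rw [this]; exact Relation.ReflTransGen.refl
  | succ i ih =>
    intro hi h3
    refine (ih (by omega) (by omega)).tail ?_
    unfold DirectlyConnected
    simp only [traj, h3, if_true, show i < 3 * k by omega]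
    rw [dist_le_one]
    push_cast
    nlinarith

lemma mover_on (k n : ℕ) (hn : n = 4 * k) (lam s : ℝ) (z : Fin n) (hz : (z : ℕ) = 0)
    (x : Fin n) (hx : 3 * k ≤ (x : ℕ)) (i : ℕ) (hi : i < 3 * k)
    (h : |tri (8 * k) (s / lam) - ((x : ℝ) - 3 * k) * (1 + 1 / k) - i| ≤ 5 / 13) :
    EpsConnected (fun x : Fin n => traj k lam x) (1 / 2) s z x := by
  refine (core_conn k n hn lam s z hz i (by omega) hi).tail ?_
  unfold DirectlyConnected
  simp only [traj, hi, if_true, show ¬ (x : ℕ) < 3 * k by omega, if_false]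
  rw [dist_le_one]
  have := abs_le.1 h
  nlinarith

lemma mover_off (k n : ℕ) (hk : 0 < k) (lam s : ℝ) (z : Fin n) (hz : (z : ℕ) = 0)
    (x : Fin n) (hx : 3 * k ≤ (x : ℕ))
    (h : ∀ i : ℕ, 5 / 13 < |tri (8 * k) (s / lam) - ((x : ℝ) - 3 * k) * (1 + 1 / k) - i|) :
    ¬ EpsConnected (fun x : Fin n => traj k lam x) (1 / 2) s z x := by
  intro hc
  have hc := eps_symm hc
  have hk' : (0 : ℝ) < k := by exact_mod_cast hk
  have hinv : 0 < 1 / (k : ℝ) := by positivity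
  have key : ∀ y, EpsConnected (fun x : Fin n => traj k lam x) (1 / 2) s x y → y = x := by
    intro y hy
    unfold EpsConnected at hy
    induction hy with
    | refl => rfl
    | @tail w v _ hd ih =>
      rw [ih] at hd
      clear ih
      unfold DirectlyConnected at hd
      by_cases hv : (v : ℕ) < 3 * k
      · simp only [traj, hv, if_true, show ¬ (x : ℕ) < 3 * k by omega, if_false] at hd
        rw [dist_le_one] at hd
        have h' := h v
        exfalso
        rcases lt_abs.1 h' with h' | h' <;> nlinarith
      · simp only [traj, hv, show ¬ (x : ℕ) < 3 * k by omega, if_false] at hd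
        rw [dist_le_one] at hd
        by_contra hne
        have hne' : (v : ℕ) ≠ x := fun hh => hne (Fin.ext hh)
        have h2 : (((v : ℕ) : ℝ) - (x : ℕ)) ^ 2 * (1 + 1 / (k : ℝ)) ^ 2 ≤ 1 := by
          refine le_trans (le_of_eq ?_) hd
          ring
        have h3 : (1 : ℝ) ≤ (((v : ℕ) : ℝ) - (x : ℕ)) ^ 2 := by
          rcases Nat.lt_or_gt_of_ne hne' with h4 | h4
          · have : ((v : ℕ) : ℝ) + 1 ≤ (x : ℕ) := by exact_mod_cast h4
            nlinarith
          · have : ((x : ℕ) : ℝ) + 1 ≤ (v : ℕ) := by exact_mod_cast h4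
            nlinarith
        have h4 : 1 < (1 + 1 / (k : ℝ)) ^ 2 := by nlinarith
        nlinarith
  have := key z hc
  have : (x : ℕ) = 0 := by rw [← this]; exact hz
  omega

/-- For each `q`, a mover whose on-interval is centred at `q / k`. -/
lemma exists_mover (k n : ℕ) (hk : 0 < k) (hn : n = 4 * k) (lam : ℝ) (z : Fin n)
    (hz : (z : ℕ) = 0) (q : ℕ) (hq1 : k * k ≤ q) (hq2 : q < 3 * k * k) :
    ∃ x : Fin n,
      (∀ s, |tri (8 * k) (s / lam) - q / k| ≤ 5 / 13 →
        EpsConnected (fun x : Fin n => traj k lam x) (1 / 2) s z x) ∧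
      (∀ s, 5 / 13 < |tri (8 * k) (s / lam) - q / k| →
        |tri (8 * k) (s / lam) - q / k| < 8 / 13 →
        ¬ EpsConnected (fun x : Fin n => traj k lam x) (1 / 2) s z x) := by
  have hmod := Nat.mod_lt q hk
  have hdm := Nat.div_add_mod q k
  have hd1 : k ≤ q / k := (Nat.le_div_iff_mul_le hk).2 hq1
  have hd2 : q / k < 3 * k := (Nat.div_lt_iff_lt_mul hk).2 hq2
  have hk' : (0 : ℝ) < k := by exact_mod_cast hk
  obtain ⟨i, hi⟩ : ∃ i, q / k = q % k + i := ⟨q / k - q % k, by omega⟩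
  have hc : (q : ℝ) / k = ((q % k : ℕ) : ℝ) * (1 + 1 / k) + i := by
    have : (q : ℝ) = k * (((q % k : ℕ) : ℝ) + i) + ((q % k : ℕ) : ℝ) := by
      rw [hi] at hdm
      exact_mod_cast hdm.symm
    rw [this]; field_simp
    ring
  have hx : ((3 * k + q % k : ℕ) : ℝ) - 3 * k = ((q % k : ℕ) : ℝ) := by push_cast; ring
  refine ⟨⟨3 * k + q % k, by omega⟩, ?_, ?_⟩
  · intro s hs
    refine mover_on k n hn lam s z hz _ (by simp) i (by omega) ?_
    simp only [hx]
    rw [hc] at hs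
    convert hs using 2
    ring
  · intro s h1 h2
    refine mover_off k n hk lam s z hz _ (by simp) ?_
    intro i'
    simp only [hx]
    set e := ((q % k : ℕ) : ℝ) * (1 + 1 / k)
    set u := tri (8 * k) (s / lam)
    have h2' := abs_lt.1 h2
    rcases lt_trichotomy i' i with h | h | h
    · have : (i' : ℝ) + 1 ≤ i := by exact_mod_cast h
      rw [lt_abs]; left; linarith
    · subst h
      rw [hc] at h1
      convert h1 using 2
      ring
    · have : (i : ℝ) + 1 ≤ i' := by exact_mod_cast h
      rw [lt_abs]; right; linarith

lemma one_group (k n : ℕ) (hk : 0 < k) (hn : n = 4 * k) (τ m : ℕ) (hm : m ≤ 3 * k) (δ : ℝ)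
    (hδ : 0 ≤ δ) (z : Fin n) (hz : (z : ℕ) = 0) (r q j : ℕ) (hr : 2 * r < τ)
    (hq : k * k ≤ q) (hq2 : q + j < 3 * k * k) (hj : 2 * j ≤ k) :
    IsMaximalGroup (fun x : Fin n => traj k (4 * δ + 1) x) (1 / 2) m δ
      ((4 * δ + 1) * (4 * k) * ((0 : ℕ) : ℝ)) ((4 * δ + 1) * (4 * k) * (τ : ℝ))
      (grp (fun x : Fin n => traj k (4 * δ + 1) x) (1 / 2) z
        ((4 * δ + 1) * (8 * k * r + (q + j : ℕ) / k - 5 / 13))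
        ((4 * δ + 1) * (8 * k * r + (q : ℕ) / k + 5 / 13)))
      ((4 * δ + 1) * (8 * k * r + (q + j : ℕ) / k - 5 / 13))
      ((4 * δ + 1) * (8 * k * r + (q : ℕ) / k + 5 / 13)) := by
  obtain ⟨lam, hlam⟩ : ∃ lam, lam = 4 * δ + 1 := ⟨_, rfl⟩
  rw [← hlam]
  have hl : 0 < lam := by linarith
  have hk' : (1 : ℝ) ≤ k := by exact_mod_cast hk
  have hk0 : (0 : ℝ) < k := by linarith
  obtain ⟨x1, on1, off1⟩ := exists_mover k n hk hn lam z hz (q + j) (by omega) hq2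
  obtain ⟨x2, on2, off2⟩ := exists_mover k n hk hn lam z hz q hq (by omega)
  have b1 : (k : ℝ) ≤ (q : ℝ) / k := by
    rw [le_div_iff₀ hk0]; exact_mod_cast hq
  have b2 : ((q + j : ℕ) : ℝ) / k ≤ 3 * k := by
    rw [div_le_iff₀ hk0]; exact_mod_cast hq2.le
  have b3 : ((q + j : ℕ) : ℝ) / k = (q : ℝ) / k + (j : ℝ) / k := by push_cast; ring
  have b4 : (j : ℝ) / k ≤ 1 / 2 := by
    rw [div_le_iff₀ hk0]
    have : (2 : ℝ) * j ≤ k := by exact_mod_cast hj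
    linarith
  have b5 : (0 : ℝ) ≤ (j : ℝ) / k := by positivity
  set A := ((q + j : ℕ) : ℝ) / k with hA
  set B := (q : ℝ) / k with hB
  have htri : ∀ u : ℝ, 0 ≤ u → u ≤ 4 * k → tri (8 * k) (lam * (8 * k * r + u) / lam) = u := by
    intro u h0 h1
    rw [mul_div_cancel_left₀ _ hl.ne', tri_up (by positivity) (r : ℤ)]
    · push_cast; ring
    · push_cast; linarith
    · push_cast; linarith
  have hpar : ∀ s : ℝ, s = lam * (8 * k * r + (s / lam - 8 * k * r)) := by
    intro s; field_simp; ring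
  have rng : ∀ s ∈ Icc (lam * (8 * k * r + A - 5 / 13)) (lam * (8 * k * r + B + 5 / 13)),
      ∃ u, A - 5 / 13 ≤ u ∧ u ≤ B + 5 / 13 ∧ tri (8 * k) (s / lam) = u := by
    rintro s ⟨h1, h2⟩
    have h1' : 8 * k * r + A - 5 / 13 ≤ s / lam := by rw [le_div_iff₀ hl]; linarith
    have h2' : s / lam ≤ 8 * k * r + B + 5 / 13 := by rw [div_le_iff₀ hl]; linarith
    refine ⟨s / lam - 8 * k * r, by linarith, by linarith, ?_⟩
    have := htri (s / lam - 8 * k * r) (by linarith) (by linarith)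
    rwa [← hpar s] at this
  have hrτ : (2 : ℝ) * r + 1 ≤ τ := by exact_mod_cast hr
  refine max_of _ _ _ _ _ _ z _ _ ?_ ?_ ?_ ?_ ?_ x1 x2 ?_ ?_ ?_ ?_
  · refine hm.trans ?_
    have hsub : (Finset.univ.filter (fun x : Fin n => (x : ℕ) < 3 * k)) ⊆
        grp (fun x : Fin n => traj k lam x) (1 / 2) z
        (lam * (8 * k * r + A - 5 / 13)) (lam * (8 * k * r + B + 5 / 13)) := by
      intro x hx
      simp only [Finset.mem_filter, Finset.mem_univ, true_and] at hx
      simp only [grp, Finset.mem_filter, Finset.mem_univ, true_and]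
      intro s _
      exact core_conn k n hn lam s z hz x x.2 hx
    refine le_trans ?_ (Finset.card_le_card hsub)
    rw [Fin.card_filter_val_lt]
    omega
  · have : 0 ≤ 8 * k * r + A - 5 / 13 := by
      have : (0 : ℝ) ≤ 8 * k * r := by positivity
      linarith
    simp only [Nat.cast_zero, mul_zero]
    positivity
  · apply mul_le_mul_of_nonneg_left _ hl.le
    linarith
  · have : 8 * k * r + B + 5 / 13 ≤ 4 * k * τ := by nlinarith
    calc _ ≤ lam * (4 * k * τ) := mul_le_mul_of_nonneg_left this hl.le
      _ = _ := by ring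
  · have : lam * (7 / 26) ≤ lam * (B - A + 10 / 13) := by
      apply mul_le_mul_of_nonneg_left _ hl.le
      linarith
    linarith
  · intro s hs
    obtain ⟨u, h1, h2, h3⟩ := rng s hs
    refine on1 s ?_
    rw [h3, abs_le]; constructor <;> linarith
  · intro s hs
    obtain ⟨u, h1, h2, h3⟩ := rng s hs
    refine on2 s ?_
    rw [h3, abs_le]; constructor <;> linarith
  · intro c hc
    have hc' : c / lam < 8 * k * r + A - 5 / 13 := by rw [div_lt_iff₀ hl]; linarith
    obtain ⟨v, hv1, hv2⟩ := exists_between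
      (max_lt (show c / lam - 8 * k * r < A - 5 / 13 by linarith)
        (show A - 8 / 13 < A - 5 / 13 by linarith))
    obtain ⟨hv0, hv1⟩ := max_lt_iff.1 hv1
    have ht := htri v (by linarith) (by linarith)
    refine ⟨lam * (8 * k * r + v), ⟨?_, ?_⟩, off1 _ ?_ ?_⟩
    · have : c / lam ≤ 8 * k * r + v := by linarith
      rw [div_le_iff₀ hl] at this; linarith
    · apply mul_le_mul_of_nonneg_left _ hl.le; linarith
    · rw [ht, lt_abs]; right; linarith
    · rw [ht, abs_lt]; constructor <;> linarith
  · intro d hd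
    have hd' : 8 * k * r + B + 5 / 13 < d / lam := by rw [lt_div_iff₀ hl]; linarith
    obtain ⟨v, hv1, hv2⟩ := exists_between
      (lt_min (show B + 5 / 13 < d / lam - 8 * k * r by linarith)
        (show B + 5 / 13 < B + 8 / 13 by linarith))
    obtain ⟨hv0, hv2⟩ := lt_min_iff.1 hv2
    have ht := htri v (by linarith) (by linarith)
    refine ⟨lam * (8 * k * r + v), ⟨?_, ?_⟩, off2 _ ?_ ?_⟩
    · apply mul_le_mul_of_nonneg_left _ hl.le; linarith
    · have : 8 * k * r + v ≤ d / lam := by linarith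
      rw [le_div_iff₀ hl] at this; linarith
    · rw [ht, lt_abs]; left; linarith
    · rw [ht, abs_lt]; constructor <;> linarith

theorem stmt_5 :
    ∃ c : ℝ, 0 < c ∧ ∀ n τ m : ℕ, 4 ∣ n → 1 ≤ τ → 1 ≤ m → m ≤ 3 * n / 4 →
      ∀ δ : ℝ, 0 ≤ δ →
      ∃ (ε : ℝ) (_ : 0 < ε) (t : Fin (τ + 1) → ℝ) (_ : StrictMono t)
        (p : Fin n → ℝ → Plane) (_ : ∀ x, IsPLTrajectory τ t (p x))
        (S : Finset (Finset (Fin n) × ℝ × ℝ)),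
        (∀ g ∈ S, IsMaximalGroup p ε m δ (t 0) (t (Fin.last τ)) g.1 g.2.1 g.2.2) ∧
        c * τ * n ^ 3 ≤ S.card := by
  classical
  refine ⟨1 / 256, by norm_num, ?_⟩
  rintro n τ m ⟨k, hn⟩ hτ hm1 hm δ hδ
  have hk : 0 < k := by omega
  have hk0 : (0 : ℝ) < k := by exact_mod_cast hk
  have hm' : m ≤ 3 * k := by omega
  have hl : 0 < 4 * δ + 1 := by linarith
  let z : Fin n := ⟨0, by omega⟩
  have hkk : k ≤ k * k := Nat.le_mul_self k
  let F : ℕ × ℕ × ℕ → Finset (Fin n) × ℝ × ℝ := fun w =>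
    (grp (fun x : Fin n => traj k (4 * δ + 1) x) (1 / 2) z
        ((4 * δ + 1) * (8 * k * w.1 + ((k * k + w.2.1) + w.2.2 : ℕ) / k - 5 / 13))
        ((4 * δ + 1) * (8 * k * w.1 + (k * k + w.2.1 : ℕ) / k + 5 / 13)),
      ((4 * δ + 1) * (8 * k * w.1 + ((k * k + w.2.1) + w.2.2 : ℕ) / k - 5 / 13)),
      ((4 * δ + 1) * (8 * k * w.1 + (k * k + w.2.1 : ℕ) / k + 5 / 13)))
  refine ⟨1 / 2, by norm_num, fun i => (4 * δ + 1) * (4 * k) * (i : ℕ), ?_,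
    fun x => traj k (4 * δ + 1) x, fun x => traj_pl k hk _ hl τ x,
    (Finset.range ((τ + 1) / 2) ×ˢ Finset.range (k * k) ×ˢ Finset.range (k / 2 + 1)).image F,
    ?_, ?_⟩
  · intro i j hij
    have : ((i : ℕ) : ℝ) < (j : ℕ) := by exact_mod_cast hij
    exact mul_lt_mul_of_pos_left this (by positivity)
  · intro g hg
    obtain ⟨⟨r, y, j⟩, hw, rfl⟩ := Finset.mem_image.1 hg
    simp only [Finset.mem_product, Finset.mem_range] at hw
    obtain ⟨h1, h2, h3⟩ := hw
    have := one_group k n hk hn τ m hm' δ hδ z rfl r (k * k + y) j (by omega) (by omega)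
      (by rw [mul_assoc]; omega) (by omega)
    simpa [F] using this
  · rw [Finset.card_image_of_injOn]
    · simp only [Finset.card_product, Finset.card_range]
      have h1 : (τ : ℝ) / 2 ≤ (((τ + 1) / 2 : ℕ) : ℝ) := by
        have : τ ≤ 2 * ((τ + 1) / 2) := by omega
        have : (τ : ℝ) ≤ 2 * (((τ + 1) / 2 : ℕ) : ℝ) := by exact_mod_cast this
        linarith
      have h2 : (k : ℝ) / 2 ≤ ((k / 2 + 1 : ℕ) : ℝ) := by
        have : k ≤ 2 * (k / 2 + 1) := by omega
        have : (k : ℝ) ≤ 2 * ((k / 2 + 1 : ℕ) : ℝ) := by exact_mod_cast this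
        linarith
      have h3 : (τ : ℝ) / 2 * ((k * k) * (k / 2)) ≤
          (((τ + 1) / 2 : ℕ) : ℝ) * ((k * k) * ((k / 2 + 1 : ℕ) : ℝ)) := by
        gcongr
      rw [Nat.cast_mul, Nat.cast_mul, Nat.cast_mul]
      refine le_trans (le_of_eq ?_) h3
      rw [hn]; push_cast; ring
    · rintro ⟨r, y, j⟩ hw ⟨r', y', j'⟩ hw' heq
      simp only [Finset.coe_product, Finset.coe_range, mem_prod, mem_Iio] at hw hw'
      simp only [F, Prod.mk.injEq] at heq
      obtain ⟨-, ha, hb⟩ := heq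
      have hb1 := mul_left_cancel₀ hl.ne' hb
      have ha1 := mul_left_cancel₀ hl.ne' ha
      have hb2 : 8 * (k * k) * r + (k * k + y) = 8 * (k * k) * r' + (k * k + y') := by
        have : (8 * (k * k) * r + (k * k + y) : ℝ) = 8 * (k * k) * r' + (k * k + y') := by
          push_cast at hb1
          field_simp at hb1
          linarith
        exact_mod_cast this
      have ha2 : 8 * (k * k) * r + (k * k + y + j) = 8 * (k * k) * r' + (k * k + y' + j') := by
        have : (8 * (k * k) * r + (k * k + y + j) : ℝ) = 8 * (k * k) * r' + (k * k + y' + j') := by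
          push_cast at ha1
          field_simp at ha1
          linarith
        exact_mod_cast this
      have hr : r = r' := by
        rcases lt_trichotomy r r' with h | h | h
        · exfalso; nlinarith [Nat.mul_le_mul_left (8 * (k * k)) (Nat.succ_le_of_lt h)]
        · exact h
        · exfalso; nlinarith [Nat.mul_le_mul_left (8 * (k * k)) (Nat.succ_le_of_lt h)]
      subst hr
      have hy : y = y' := by omega
      subst hy
      have hj : j = j' := by omega
      rw [hj]
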